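/- arXiv:1409.8604 — 2 statements merged into one kernel-verified Lean document; each statement's English description precedes it below -/
import Mathlib

section
/- Every almost indiscernible complete countable theory T is ω-stable: for every countable set A there are only countably many complete types over A. -/
open FirstOrder Language Cardinal Set

universe u v w

namespace Paper

variable {L : FirstOrder.Language.{u, v}}

/-- `a` and `b` (as `n`-tuples) satisfy the same formulas with parameters from `A`. -/
def SameType {M : Type w} [L.Structure M] (A : Set M) {n : ℕ} (a b : Fin n → M) : Prop :=
  ∀ φ : L.Formula (↥A ⊕ Fin n),
    φ.Realize (Sum.elim (fun x => (x : M)) a) ↔ φ.Realize (Sum.elim (fun x => (x : M)) b)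

/-- `a` and `b` satisfy the same formulas over the empty set. -/
def SameType₀ {M : Type w} [L.Structure M] {n : ℕ} (a b : Fin n → M) : Prop :=
  ∀ φ : L.Formula (Fin n), φ.Realize a ↔ φ.Realize b

/-- `M` is `κ`-saturated: every finitely satisfiable (in `M`) collection of formulas in one
variable over a parameter set of size `< κ` is realized in `M`. -/
def IsSat (M : Type w) [L.Structure M] (κ : Cardinal.{w}) : Prop :=
  ∀ A : Set M, #A < κ →
    ∀ p : Set (L.Formula (↥A ⊕ Fin 1)),
      (∀ S : Finset (L.Formula (↥A ⊕ Fin 1)), ↑S ⊆ p →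
        ∃ a : Fin 1 → M, ∀ φ ∈ S, φ.Realize (Sum.elim (fun x => (x : M)) a)) →
      ∃ a : Fin 1 → M, ∀ φ ∈ p, φ.Realize (Sum.elim (fun x => (x : M)) a)

/-- `b` is algebraic over `A` in `M`. -/
def InAcl {M : Type w} [L.Structure M] (A : Set M) (b : M) : Prop :=
  ∃ φ : L.Formula (↥A ⊕ Fin 1),
    φ.Realize (Sum.elim (fun x => (x : M)) (fun _ => b)) ∧
    {x : M | φ.Realize (Sum.elim (fun x => (x : M)) (fun _ => x))}.Finite

/-- A set `I` of `k`-tuples is an indiscernible set: any two injective enumerations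
of `n` elements of `I` satisfy the same formulas over `∅`. -/
def IsIndiscSet {M : Type w} [L.Structure M] {k : ℕ} (I : Set (Fin k → M)) : Prop :=
  ∀ (n : ℕ) (a b : Fin n → (Fin k → M)), Function.Injective a → Function.Injective b →
    (∀ i, a i ∈ I) → (∀ i, b i ∈ I) →
    ∀ φ : L.Formula (Fin n × Fin k),
      (φ.Realize fun p => a p.1 p.2) ↔ (φ.Realize fun p => b p.1 p.2)

/-- The set of all coordinates of the tuples in `I`. -/
def coords {M : Type w} {k : ℕ} (I : Set (Fin k → M)) : Set M :=
  ⋃ e ∈ I, Set.range e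

/-- A theory is almost indiscernible if it has a saturated model of cardinality `ℵ₁` which is
contained in the algebraic closure of an indiscernible set of finite tuples of cardinality `ℵ₁`. -/
def AlmostIndiscernible (T : L.Theory) : Prop :=
  ∃ (M : Type (max u v)) (_ : L.Structure M), M ⊨ T ∧ #M = ℵ₁ ∧ IsSat (L := L) M ℵ₁ ∧
    ∃ (k : ℕ) (I : Set (Fin k → M)), IsIndiscSet (L := L) I ∧ #I = ℵ₁ ∧ ∀ b : M, InAcl (L := L) (coords I) b

/-- A complete type over `A` in one variable, identified with a maximal finitely satisfiable
set of formulas over `A`. -/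
def IsCompleteTypeOver (M : Type w) [L.Structure M] (A : Set M)
    (p : Set (L.Formula (↥A ⊕ Fin 1))) : Prop :=
  (∀ S : Finset (L.Formula (↥A ⊕ Fin 1)), ↑S ⊆ p →
    ∃ a : Fin 1 → M, ∀ φ ∈ S, φ.Realize (Sum.elim (fun x => (x : M)) a)) ∧
  (∀ φ : L.Formula (↥A ⊕ Fin 1), φ ∈ p ∨ φ.not ∈ p)

/-- `T` is `ω`-stable: over every countable parameter set in a model of `T` there are only
countably many complete types. -/
def IsOmegaStable (T : L.Theory) : Prop :=
  ∀ (M : Type (max u v)) (_ : L.Structure M), M ⊨ T →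
    ∀ A : Set M, A.Countable → {p | IsCompleteTypeOver (L := L) M A p}.Countable

section Rank

variable {M : Type w} [L.Structure M]

/-- Realization of a formula with parameters from all of `M`. -/
def RealP {n : ℕ} (φ : L.Formula (M ⊕ Fin n)) (a : Fin n → M) : Prop :=
  φ.Realize (Sum.elim id a)

/-- Morley rank (computed in `M`) of a definable set is at least `α`. -/
def MRGe {n : ℕ} (φ : L.Formula (M ⊕ Fin n)) (α : Ordinal.{0}) : Prop :=
  (∃ a, RealP φ a) ∧ ∀ β < α, ∃ ψ : ℕ → L.Formula (M ⊕ Fin n),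
    (∀ i a, RealP (ψ i) a → RealP φ a) ∧
    (∀ i j, i ≠ j → ∀ a, ¬(RealP (ψ i) a ∧ RealP (ψ j) a)) ∧
    ∀ i, MRGe (ψ i) β
termination_by α
decreasing_by exact ‹_ < α›

/-- Morley rank (computed in `M`) is exactly `α`. -/
def MREq {n : ℕ} (φ : L.Formula (M ⊕ Fin n)) (α : Ordinal.{0}) : Prop :=
  MRGe φ α ∧ ¬ MRGe φ (α + 1)

/-- Every formula over `A` satisfied by `a` has Morley rank at least `α`. -/
def TpRkGe (A : Set M) {n : ℕ} (a : Fin n → M) (α : Ordinal.{0}) : Prop :=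
  ∀ φ : L.Formula (↥A ⊕ Fin n),
    φ.Realize (Sum.elim (fun x => (x : M)) a) →
    MRGe (L := L) (φ.relabel (Sum.map (fun x : ↥A => (x : M)) id)) α

/-- `a` is (forking-)independent from `B` over `A`: the Morley rank of its type does not
drop when the parameters are extended from `A` to `A ∪ B`. -/
def Indep (A : Set M) {n : ℕ} (a : Fin n → M) (B : Set M) : Prop :=
  ∀ α : Ordinal.{0}, TpRkGe (L := L) (A ∪ B) a α ↔ TpRkGe (L := L) A a α

/-- An independent family of realizations: each member is independent from all the others. -/
def IndepFamily (A : Set M) {n : ℕ} {ι : Type*} (J : ι → (Fin n → M)) : Prop :=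
  ∀ i : ι, Indep (L := L) A (J i) (⋃ j ∈ {j | j ≠ i}, Set.range (J j))

/-- `tp(a/A)` is stationary (w.r.t. parameter sets of size `< κ`). -/
def Stationary (κ : Cardinal.{w}) (A : Set M) {n : ℕ} (a : Fin n → M) : Prop :=
  ∀ B : Set M, A ⊆ B → #B < κ → ∀ a' a'' : Fin n → M,
    SameType (L := L) A a' a → SameType (L := L) A a'' a → Indep (L := L) A a' B → Indep (L := L) A a'' B → SameType (L := L) B a' a''

/-- `tp(a/A)` and `tp(b/B)` are nonorthogonal (w.r.t. parameter sets of size `< κ`). -/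
def Nonorthogonal (κ : Cardinal.{w}) (A : Set M) {n : ℕ} (a : Fin n → M)
    (B : Set M) {m : ℕ} (b : Fin m → M) : Prop :=
  ∃ C : Set M, A ∪ B ⊆ C ∧ #C < κ ∧ ∃ (a' : Fin n → M) (b' : Fin m → M),
    SameType (L := L) A a' a ∧ Indep (L := L) A a' C ∧ SameType (L := L) B b' b ∧
    Indep (L := L) B b' C ∧ ¬ Indep (L := L) C a' (Set.range b')

/-- `tp(a/A)` is regular: stationary, nonalgebraic, and orthogonal to all of its forking
extensions. -/
def Regular (κ : Cardinal.{w}) (A : Set M) {n : ℕ} (a : Fin n → M) : Prop :=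
  Stationary (L := L) κ A a ∧ (∃ i, ¬ InAcl (L := L) A (a i)) ∧
  ∀ B : Set M, A ⊆ B → #B < κ → ∀ a' : Fin n → M,
    SameType (L := L) A a' a → ¬ Indep (L := L) A a' B → ¬ Nonorthogonal (L := L) κ A a B a'

/-- U-rank of `tp(a/A)` is at least `α`. -/
def URkGe (κ : Cardinal.{w}) (A : Set M) {n : ℕ} (a : Fin n → M) (α : Ordinal.{0}) : Prop :=
  ∀ β < α, ∃ (B : Set M) (a' : Fin n → M), A ⊆ B ∧ #B < κ ∧
    SameType (L := L) A a' a ∧ ¬ Indep (L := L) A a' B ∧ URkGe κ B a' β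
termination_by α
decreasing_by exact ‹_ < α›

end Rank

section Algebra

/-- The theory `T` is equational: every axiom is a universally quantified equation
between terms. -/
def IsEquational (T : L.Theory) : Prop :=
  ∀ φ ∈ T, ∃ (n : ℕ) (t₁ t₂ : L.Term (Empty ⊕ Fin n)),
    φ = BoundedFormula.alls (t₁.bdEqual t₂)

/-- `A` is free on `X ⊆ A` over the class of models of `T`: `A ⊨ T` and every map from `X`
into a model of `T` extends uniquely to a homomorphism. -/
def IsFreeOn (T : L.Theory) (A : Type w) [L.Structure A] (X : Set A) : Prop :=
  A ⊨ T ∧ ∀ (B : Type w) (_ : L.Structure B), B ⊨ T →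
    ∀ f : X → B, ∃! h : A →[L] B, ∀ x : X, h x = f x

/-- An element of a free algebra is basic if it belongs to some basis. -/
def IsBasic (T : L.Theory) {M : Type w} [L.Structure M] (a : M) : Prop :=
  ∃ X : Set M, a ∈ X ∧ IsFreeOn T M X

/-- A subset of a free algebra is basic if it is contained in some basis. -/
def IsBasicSet (T : L.Theory) {M : Type w} [L.Structure M] (A : Set M) : Prop :=
  ∃ X : Set M, A ⊆ X ∧ IsFreeOn T M X

end Algebra

/-- Tarski–Vaught style: `S` is the underlying set of an elementary substructure. -/
def IsElemSubset {M : Type w} [L.Structure M] (S : Set M) : Prop :=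
  S.Nonempty ∧ ∀ (n : ℕ) (φ : L.Formula (Fin (n + 1))) (a : Fin n → M),
    (∀ i, a i ∈ S) → (∃ x : M, φ.Realize (Fin.snoc a x)) →
    ∃ x ∈ S, φ.Realize (Fin.snoc a x)

/-- Every type over a parameter subset of `S` of size `< κ` that is finitely satisfiable in `M`
is realized inside `S`. -/
def SatInside {M : Type w} [L.Structure M] (S : Set M) (κ : Cardinal.{w}) : Prop :=
  ∀ A : Set M, A ⊆ S → #A < κ →
    ∀ p : Set (L.Formula (↥A ⊕ Fin 1)),
      (∀ Sf : Finset (L.Formula (↥A ⊕ Fin 1)), ↑Sf ⊆ p →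
        ∃ a : Fin 1 → M, ∀ φ ∈ Sf, φ.Realize (Sum.elim (fun x => (x : M)) a)) →
      ∃ a : Fin 1 → M, a 0 ∈ S ∧ ∀ φ ∈ p, φ.Realize (Sum.elim (fun x => (x : M)) a)

end Paper

namespace Paper

section Aux

variable {L : FirstOrder.Language.{u, v}} {M : Type w} [L.Structure M]

/-- evaluate coordinates of a family of tuples -/
def ev {X : Type*} {k : ℕ} (t : X → Fin k → M) : X × Fin k → M := fun p => t p.1 p.2

/-- `b` is algebraic over the coordinates of the family `t` -/
def AlgOver (L : FirstOrder.Language.{u, v}) [L.Structure M] {X : Type w} {k : ℕ}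
    (t : X → Fin k → M) (b : M) : Prop :=
  ∃ φ : L.Formula ((X × Fin k) ⊕ Fin 1), φ.Realize (Sum.elim (ev t) (fun _ => b)) ∧
    {x : M | φ.Realize (Sum.elim (ev t) (fun _ => x))}.Finite

theorem fin_supp {α : Type*} (φ : L.Formula α) : ∃ (s : Finset α) (ψ : L.Formula s),
    ∀ v : α → M, φ.Realize v ↔ ψ.Realize (fun x : s => v x) := by
  classical
  refine ⟨φ.freeVarFinset, BoundedFormula.restrictFreeVar φ id, fun v => ?_⟩
  exact (BoundedFormula.realize_restrictFreeVar (φ := φ) (f := id) v (fun _ => rfl)).symm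

theorem AlgOver.mono {X Y : Type w} {k : ℕ} {t : X → Fin k → M} {t' : Y → Fin k → M} (f : X → Y)
    (hf : ∀ x, t' (f x) = t x) {b : M} (h : AlgOver L t b) : AlgOver L t' b := by
  obtain ⟨φ, h1, h2⟩ := h
  have key : ∀ x : M, (φ.relabel (Sum.map (Prod.map f id) id)).Realize
      (Sum.elim (ev t') (fun _ : Fin 1 => x)) ↔ φ.Realize (Sum.elim (ev t) (fun _ => x)) := by
    intro x
    rw [Formula.realize_relabel]
    have : (Sum.elim (ev t') (fun _ : Fin 1 => x)) ∘ (Sum.map (Prod.map f id) id) =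
      Sum.elim (ev t) (fun _ => x) := by
      funext p
      rcases p with ⟨a, i⟩ | i <;> simp [ev, hf]
    rw [this]
  exact ⟨φ.relabel (Sum.map (Prod.map f id) id), (key b).2 h1, by simpa only [key] using h2⟩

theorem alg_form {k : ℕ} (I : Set (Fin k → M)) (b : M) (hb : InAcl (L := L) (coords I) b) :
    ∃ S : Set (Fin k → M), S ⊆ I ∧ S.Finite ∧ AlgOver L (fun x : S => x.1) b := by
  classical
  obtain ⟨φ, h1, h2⟩ := hb
  have hc : ∀ x : coords I, ∃ e : I × Fin k, e.1.1 e.2 = x.1 := by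
    rintro ⟨x, hx⟩
    simp only [coords, mem_iUnion, mem_range] at hx
    obtain ⟨e, he, i, hi⟩ := hx
    exact ⟨(⟨e, he⟩, i), hi⟩
  choose f hf using hc
  obtain ⟨s, ψ, hψ⟩ := fin_supp (M := M) φ
  let S : Set (Fin k → M) := {e | ∃ x : coords I, Sum.inl x ∈ s ∧ (f x).1.1 = e}
  have hS : S.Finite := by
    have : S ⊆ Set.image (fun x : coords I ⊕ Fin 1 =>
        Sum.elim (fun x => (f x).1.1) (fun _ _ => b) x) s := by
      rintro e ⟨x, hx, rfl⟩
      exact ⟨_, hx, rfl⟩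
    exact (s.finite_toSet.image _).subset this
  let r : s → (S × Fin k) ⊕ Fin 1 := fun x => match x with
    | ⟨Sum.inl y, hy⟩ => Sum.inl (⟨(f y).1.1, y, hy, rfl⟩, (f y).2)
    | ⟨Sum.inr i, _⟩ => Sum.inr i
  have key : ∀ x : M, (ψ.relabel r).Realize
      (Sum.elim (ev fun x : S => x.1) (fun _ : Fin 1 => x)) ↔
      φ.Realize (Sum.elim (fun x => (x : M)) (fun _ => x)) := by
    intro x
    rw [Formula.realize_relabel, hψ]
    have : (Sum.elim (ev fun x : S => x.1) (fun _ : Fin 1 => x)) ∘ r =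
      fun y : s => Sum.elim (fun x : coords I => (x : M)) (fun _ : Fin 1 => x) y := by
      funext p
      rcases p with ⟨y | i, hy⟩
      · simp [r, ev, hf]
      · simp [r]
    rw [this]
  refine ⟨S, ?_, hS, ψ.relabel r, (key b).2 h1, by simpa only [key] using h2⟩
  rintro e ⟨x, _, rfl⟩
  exact (f x).1.2

theorem indisc {k : ℕ} {I : Set (Fin k → M)} (hI : IsIndiscSet (L := L) I) {X : Type*}
    (σ τ : X → Fin k → M) (hσ : Function.Injective σ) (hτ : Function.Injective τ)
    (hσI : ∀ x, σ x ∈ I) (hτI : ∀ x, τ x ∈ I) (φ : L.Formula (X × Fin k)) :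
    φ.Realize (ev σ) ↔ φ.Realize (ev τ) := by
  classical
  obtain ⟨s, ψ, hψ⟩ := fin_supp (M := M) φ
  let t := s.image Prod.fst
  let e := t.equivFin
  let r : s → Fin t.card × Fin k := fun x => (e ⟨x.1.1, Finset.mem_image_of_mem _ x.2⟩, x.1.2)
  have key : ∀ ρ : X → Fin k → M, φ.Realize (ev ρ) ↔
      (ψ.relabel r).Realize (fun p => ρ (e.symm p.1).1 p.2) := by
    intro ρ
    rw [hψ, Formula.realize_relabel]
    have : (fun p : Fin t.card × Fin k => ρ (e.symm p.1).1 p.2) ∘ r = fun x : s => ev ρ x.1 := by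
      funext x
      simp [r, ev]
    rw [this]
  rw [key, key]
  exact hI _ (fun i => σ (e.symm i).1) (fun i => τ (e.symm i).1)
    (fun a b hab => e.symm.injective (Subtype.ext (hσ hab)))
    (fun a b hab => e.symm.injective (Subtype.ext (hτ hab))) (fun _ => hσI _) (fun _ => hτI _) _

theorem transfer {N : Type w} [L.Structure N] (hsat : IsSat (L := L) M ℵ₁) {ι : Type*}
    [Countable ι] (h : ι → M) (g : ι → N)
    (hgh : ∀ φ : L.Formula ι, φ.Realize g ↔ φ.Realize h) (p : Set (L.Formula (ι ⊕ Fin 1)))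
    (hp : ∀ S : Finset (L.Formula (ι ⊕ Fin 1)), ↑S ⊆ p →
      ∃ a : Fin 1 → N, ∀ φ ∈ S, φ.Realize (Sum.elim g a)) :
    ∃ c : Fin 1 → M, ∀ φ ∈ p, φ.Realize (Sum.elim h c) := by
  classical
  let r : ι ⊕ Fin 1 → (range h) ⊕ Fin 1 := Sum.map (rangeFactorization h) id
  have hr : ∀ (φ : L.Formula (ι ⊕ Fin 1)) (a : Fin 1 → M), (φ.relabel r).Realize
      (Sum.elim (fun x => (x : M)) a) ↔ φ.Realize (Sum.elim h a) := by
    intro φ a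
    rw [Formula.realize_relabel]
    have : Sum.elim (fun x : range h => (x : M)) a ∘ r = Sum.elim h a := by
      funext x
      rcases x with x | x <;> simp [r]
    rw [this]
  have hc : #(range h) < ℵ₁ := by
    have : #(range h) ≤ ℵ₀ := Cardinal.mk_le_aleph0_iff.2 (countable_range h).to_subtype
    exact this.trans_lt Cardinal.aleph0_lt_aleph_one
  obtain ⟨a, ha⟩ := hsat (range h) hc (Set.image (Formula.relabel r) p) (by
    intro S hS
    obtain ⟨S', hS', rfl⟩ := Finset.subset_set_image_iff.1 hS
    obtain ⟨a, ha⟩ := hp S' hS'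
    have := (hgh (Formula.iExs (Fin 1) (Formula.iInf fun φ : S' => φ.1))).1 (by
      rw [Formula.realize_iExs]
      refine ⟨a, ?_⟩
      rw [Formula.realize_iInf]
      exact fun φ => ha _ φ.2)
    rw [Formula.realize_iExs] at this
    obtain ⟨b, hb⟩ := this
    rw [Formula.realize_iInf] at hb
    refine ⟨b, ?_⟩
    intro φ hφ
    obtain ⟨φ', h', rfl⟩ := Finset.mem_image.1 hφ
    exact (hr _ _).2 (hb ⟨φ', h'⟩))
  exact ⟨a, fun φ hφ => (hr _ _).1 (ha _ ⟨φ, hφ, rfl⟩)⟩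

theorem embed {N : Type w} [L.Structure N] (hsat : IsSat (L := L) M ℵ₁)
    (h0 : ∀ (φ : L.Formula (Fin 0)) (a : Fin 0 → N) (b : Fin 0 → M), φ.Realize a ↔ φ.Realize b)
    [Nonempty M] (g : ℕ → N) :
    ∃ h : ℕ → M, ∀ φ : L.Formula ℕ, φ.Realize g ↔ φ.Realize h := by
  classical
  let Good : ℕ → (ℕ → M) → Prop := fun n h =>
    ∀ φ : L.Formula (Fin n), φ.Realize (fun i => g i) ↔ φ.Realize (fun i => h i)
  have step : ∀ n h, Good n h → ∃ c, Good (n + 1) (Function.update h n c) := by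
    intro n h hh
    let r : Fin (n + 1) → Fin n ⊕ Fin 1 := Fin.lastCases (Sum.inr 0) (fun i => Sum.inl i)
    have hr : ∀ {P : Type w} (f : Fin (n+1) → P), Sum.elim (fun i : Fin n => f i.castSucc)
        (fun _ : Fin 1 => f (Fin.last n)) ∘ r = f := by
      intro P f
      funext i
      refine Fin.lastCases ?_ (fun i => ?_) i <;> simp [r]
    obtain ⟨c, hc⟩ := transfer (L := L) hsat (fun i : Fin n => h i) (fun i : Fin n => g i) hh
      {φ | φ.Realize (Sum.elim (fun i : Fin n => g i) (fun _ => g n))}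
      (fun S hS => ⟨fun _ => g n, fun φ hφ => hS hφ⟩)
    have hc' : ∀ φ : L.Formula (Fin n ⊕ Fin 1),
        φ.Realize (Sum.elim (fun i : Fin n => g i) (fun _ => g n)) ↔
        φ.Realize (Sum.elim (fun i : Fin n => h i) c) := by
      intro φ
      refine ⟨hc φ, fun h1 => ?_⟩
      by_contra h2
      exact Formula.realize_not.1 (hc φ.not (Formula.realize_not.2 h2)) h1
    refine ⟨c 0, fun φ => ?_⟩
    have := hc' (φ.relabel r)
    rw [Formula.realize_relabel, Formula.realize_relabel] at this
    have e1 := hr (fun i : Fin (n+1) => g i)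
    have e2 := hr (fun i : Fin (n+1) => Function.update h n (c 0) i)
    have e3 : (fun i : Fin n => Function.update h n (c 0) (i.castSucc : Fin (n+1))) =
        fun i : Fin n => h i := by
      funext i
      simp [i.2.ne]
    have e4 : (fun _ : Fin 1 => Function.update h n (c 0) (Fin.last n)) = c := by
      funext i
      simp [Subsingleton.elim i 0]
    rw [e3, e4] at e2
    rw [e2] at this
    simp only [Fin.val_castSucc, Fin.val_last] at e1
    rw [e1] at this
    exact this
  let H : ∀ n, {h // Good n h} := fun n => Nat.rec
    ⟨fun _ => Classical.arbitrary M, fun φ => h0 φ _ _⟩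
    (fun n h => ⟨_, (step n h.1 h.2).choose_spec⟩) n
  have hH : ∀ n i, i ≠ n → (H (n + 1)).1 i = (H n).1 i := by
    intro n i hi
    change Function.update (H n).1 n _ i = _
    simp [hi]
  have hH' : ∀ i n, i < n → (H n).1 i = (H (i + 1)).1 i := by
    intro i n hn
    induction n, hn using Nat.le_induction with
    | base => rfl
    | succ n hn ih => rw [hH n i (by omega), ih]
  refine ⟨fun n => (H (n + 1)).1 n, fun φ => ?_⟩
  let φ' := BoundedFormula.restrictFreeVar φ (id : φ.freeVarFinset → φ.freeVarFinset)
  have hφ : ∀ {P : Type w} [L.Structure P] (f : ℕ → P),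
      φ.Realize f ↔ Formula.Realize φ' (fun x => f x) := fun f =>
    (BoundedFormula.realize_restrictFreeVar (φ := φ) (f := id) f (fun _ => rfl)).symm
  let n := φ.freeVarFinset.sup id + 1
  have hn : ∀ x : φ.freeVarFinset, x.1 < n := fun x =>
    Nat.lt_succ_of_le (Finset.le_sup (f := id) x.2)
  have := (H n).2 (Formula.relabel (fun x => (⟨x.1, hn x⟩ : Fin n)) φ')
  rw [Formula.realize_relabel, Formula.realize_relabel] at this
  rw [hφ, hφ]
  have e : (fun x : φ.freeVarFinset => (H (x.1 + 1)).1 x.1) = (fun i : Fin n => (H n).1 i) ∘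
      (fun x : φ.freeVarFinset => (⟨x.1, hn x⟩ : Fin n)) := by
    funext x
    exact (hH' _ _ (hn x)).symm
  rw [e]
  exact this

theorem key_fin {k : ℕ} {I : Set (Fin k → M)} (hI : IsIndiscSet (L := L) I)
    {E : Set (Fin k → M)} (hE : E ⊆ I) (hW : (I \ E).Infinite) {F Z : Type*} [Finite F] [Finite Z]
    (y : F → M) (A : L.Formula (F ⊕ (E × Fin k)))
    (hA : A.Realize (Sum.elim y (ev fun x : E => x.1)))
    (hAf : {y : F → M | A.Realize (Sum.elim y (ev fun x : E => x.1))}.Finite)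
    (Θ : L.Formula (F ⊕ ((E ⊕ Z) × Fin k))) (d d' : Z → Fin k → M)
    (hd : Function.Injective d) (hd' : Function.Injective d')
    (hdW : ∀ z, d z ∈ I \ E) (hdW' : ∀ z, d' z ∈ I \ E) :
    Θ.Realize (Sum.elim y (ev (Sum.elim (fun x : E => x.1) d))) ↔
    Θ.Realize (Sum.elim y (ev (Sum.elim (fun x : E => x.1) d'))) := by
  classical
  let a : F ⊕ (E × Fin k) → ((E ⊕ (Z ⊕ Z)) × Fin k) ⊕ F :=
    Sum.elim Sum.inr (fun p => Sum.inl (Sum.inl p.1, p.2))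
  let b1 : F ⊕ ((E ⊕ Z) × Fin k) → ((E ⊕ (Z ⊕ Z)) × Fin k) ⊕ F :=
    Sum.elim Sum.inr (fun p => Sum.inl (Sum.map id Sum.inl p.1, p.2))
  let b2 : F ⊕ ((E ⊕ Z) × Fin k) → ((E ⊕ (Z ⊕ Z)) × Fin k) ⊕ F :=
    Sum.elim Sum.inr (fun p => Sum.inl (Sum.map id Sum.inr p.1, p.2))
  let Φ : L.Formula ((E ⊕ (Z ⊕ Z)) × Fin k) :=
    Formula.iAlls F ((A.relabel a).imp ((Θ.relabel b1).iff (Θ.relabel b2)))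
  let R : (Z → Fin k → M) → (F → M) → Prop := fun d y =>
    Θ.Realize (Sum.elim y (ev (Sum.elim (fun x : E => x.1) d)))
  have hΦ : ∀ d d' : Z → Fin k → M,
      Φ.Realize (ev (Sum.elim (fun x : E => x.1) (Sum.elim d d'))) ↔
      ∀ y : F → M, A.Realize (Sum.elim y (ev fun x : E => x.1)) → (R d y ↔ R d' y) := by
    intro d d'
    simp only [Φ, Formula.realize_iAlls, Formula.realize_imp, Formula.realize_iff,
      Formula.realize_relabel]
    refine forall_congr' fun y => ?_
    have e1 : (Sum.elim (ev (Sum.elim (fun x : E => x.1) (Sum.elim d d'))) y) ∘ a =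
        Sum.elim y (ev fun x : E => x.1) := by
      funext x
      rcases x with x | ⟨x, i⟩ <;> simp [a, ev]
    have e2 : (Sum.elim (ev (Sum.elim (fun x : E => x.1) (Sum.elim d d'))) y) ∘ b1 =
        Sum.elim y (ev (Sum.elim (fun x : E => x.1) d)) := by
      funext x
      rcases x with x | ⟨x | x, i⟩ <;> simp [b1, ev]
    have e3 : (Sum.elim (ev (Sum.elim (fun x : E => x.1) (Sum.elim d d'))) y) ∘ b2 =
        Sum.elim y (ev (Sum.elim (fun x : E => x.1) d')) := by
      funext x
      rcases x with x | ⟨x | x, i⟩ <;> simp [b2, ev]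
    rw [e1, e2, e3]
  have hinf : ((I \ E) \ (range d ∪ range d')).Infinite :=
    hW.sdiff ((finite_range d).union (finite_range d'))
  have hinf' := hinf.to_subtype
  obtain ⟨enc, henc⟩ := exists_injective_nat (ℕ × Z)
  let ρ : ℕ → Z → Fin k → M := fun n z => (Infinite.natEmbedding _ (enc (n, z)) :
    ↥((I \ E) \ (range d ∪ range d'))).1
  have hρ : ∀ n z n' z', ρ n z = ρ n' z' → n = n' ∧ z = z' := by
    intro n z n' z' hh
    have := henc ((Infinite.natEmbedding _).injective (Subtype.ext hh))
    simpa using this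
  have hρ' : ∀ n z, ρ n z ∈ (I \ E) \ (range d ∪ range d') := fun n z => Subtype.property _
  have comb : ∀ d d' : Z → Fin k → M, Function.Injective d → Function.Injective d' →
      (∀ z, d z ∈ I \ E) → (∀ z, d' z ∈ I \ E) → (∀ z z', d z ≠ d' z') →
      Function.Injective (Sum.elim (fun x : E => x.1) (Sum.elim d d')) ∧
      ∀ x, Sum.elim (fun x : E => x.1) (Sum.elim d d') x ∈ I := by
    intro d d' h1 h2 h3 h4 h5
    refine ⟨Function.Injective.sumElim Subtype.val_injective
      (Function.Injective.sumElim h1 h2 h5) ?_, ?_⟩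
    · rintro ⟨x, hx⟩ (z | z) hh
      · exact (h3 z).2 ((show x = d z from hh) ▸ hx)
      · exact (h4 z).2 ((show x = d' z from hh) ▸ hx)
    · rintro (⟨x, hx⟩ | z | z)
      · exact hE hx
      · exact (h3 z).1
      · exact (h4 z).1
  have := hAf.to_subtype
  obtain ⟨i, j, hij, hR⟩ := Finite.exists_ne_map_eq_of_infinite
    (fun n : ℕ => {y : {y : F → M | A.Realize (Sum.elim y (ev fun x : E => x.1))} | R (ρ n) y.1})
  have ρinj : ∀ n, Function.Injective (ρ n) := fun n z z' hh => (hρ n z n z' hh).2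
  have ρmem : ∀ n z, ρ n z ∈ I \ E := fun n z => (hρ' n z).1
  have c0 := comb (ρ i) (ρ j) (ρinj i) (ρinj j) (ρmem i) (ρmem j)
    (fun z z' hh => hij (hρ _ _ _ _ hh).1)
  have base : Φ.Realize (ev (Sum.elim (fun x : E => x.1) (Sum.elim (ρ i) (ρ j)))) := by
    rw [hΦ]
    intro y hy
    have := congrArg (fun s => (⟨y, hy⟩ : {y : F → M | A.Realize (Sum.elim y (ev fun x : E => x.1))}) ∈ s) hR
    exact iff_of_eq this
  have c1 := comb d (ρ 0) hd (ρinj 0) hdW (ρmem 0)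
    (fun z z' hh => (hρ' 0 z').2 (Or.inl ⟨z, hh⟩))
  have c2 := comb d' (ρ 0) hd' (ρinj 0) hdW' (ρmem 0)
    (fun z z' hh => (hρ' 0 z').2 (Or.inr ⟨z, hh⟩))
  have r1 := (hΦ _ _).1 ((indisc hI _ _ c0.1 c1.1 c0.2 c1.2 Φ).1 base) y hA
  have r2 := (hΦ _ _).1 ((indisc hI _ _ c0.1 c2.1 c0.2 c2.2 Φ).1 base) y hA
  exact r1.trans r2.symm

theorem key_nat {k : ℕ} {I : Set (Fin k → M)} (hI : IsIndiscSet (L := L) I)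
    {E : Set (Fin k → M)} (hE : E ⊆ I) (hW : (I \ E).Infinite) {Z : Type*} [Finite Z]
    (h : ℕ → M) (hh : ∀ n, AlgOver L (fun x : E => x.1) (h n))
    (Θ : L.Formula (ℕ ⊕ ((E ⊕ Z) × Fin k))) (d d' : Z → Fin k → M)
    (hd : Function.Injective d) (hd' : Function.Injective d')
    (hdW : ∀ z, d z ∈ I \ E) (hdW' : ∀ z, d' z ∈ I \ E) :
    Θ.Realize (Sum.elim h (ev (Sum.elim (fun x : E => x.1) d))) ↔
    Θ.Realize (Sum.elim h (ev (Sum.elim (fun x : E => x.1) d'))) := by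
  classical
  choose φ h1 h2 using hh
  obtain ⟨s, ψ, hψ⟩ := fin_supp (M := M) Θ
  let F : Set ℕ := {n | Sum.inl n ∈ s}
  have hF : Finite F := (s.finite_toSet.preimage Sum.inl_injective.injOn).to_subtype
  let r : s → F ⊕ ((E ⊕ Z) × Fin k) := fun x => match x with
    | ⟨Sum.inl n, hn⟩ => Sum.inl ⟨n, hn⟩
    | ⟨Sum.inr p, _⟩ => Sum.inr p
  have key : ∀ w : ((E ⊕ Z) × Fin k) → M, Θ.Realize (Sum.elim h w) ↔
      (ψ.relabel r).Realize (Sum.elim (fun n : F => h n) w) := by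
    intro w
    rw [hψ, Formula.realize_relabel]
    have : (Sum.elim (fun n : F => h n) w) ∘ r = fun x : s => Sum.elim h w x.1 := by
      funext x
      rcases x with ⟨n | p, hx⟩ <;> simp [r]
    rw [this]
  let A : L.Formula (F ⊕ (E × Fin k)) := Formula.iInf fun n : F =>
    (φ n).relabel (Sum.elim Sum.inr (fun _ => Sum.inl n))
  have hA : ∀ y : F → M, A.Realize (Sum.elim y (ev fun x : E => x.1)) ↔
      ∀ n : F, (φ n).Realize (Sum.elim (ev fun x : E => x.1) (fun _ => y n)) := by
    intro y
    simp only [A, Formula.realize_iInf, Formula.realize_relabel]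
    refine forall_congr' fun n => ?_
    have : (Sum.elim y (ev fun x : E => x.1)) ∘ (Sum.elim Sum.inr (fun _ : Fin 1 => Sum.inl n)) =
        Sum.elim (ev fun x : E => x.1) (fun _ => y n) := by
      funext x
      rcases x with x | x <;> simp
    rw [this]
  rw [key, key]
  refine key_fin hI hE hW _ A ((hA _).2 fun n => h1 n) ?_ _ d d' hd hd' hdW hdW'
  simp only [hA]
  exact (Set.Finite.pi' fun n : F => h2 n)

theorem fin_transfer {k : ℕ} {I : Set (Fin k → M)} (hI : IsIndiscSet (L := L) I) {X : Type*}
    (σ τ : X → Fin k → M) (hσ : Function.Injective σ) (hτ : Function.Injective τ)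
    (hσI : ∀ x, σ x ∈ I) (hτI : ∀ x, τ x ∈ I) (φ : L.Formula ((X × Fin k) ⊕ Fin 1))
    (hf : {x : M | φ.Realize (Sum.elim (ev σ) (fun _ => x))}.Finite) :
    {x : M | φ.Realize (Sum.elim (ev τ) (fun _ => x))}.Finite := by
  classical
  let F := ↥{x : M | φ.Realize (Sum.elim (ev σ) (fun _ => x))}
  have : Finite F := hf.to_subtype
  let Φ : L.Formula (X × Fin k) := Formula.iExs F (Formula.iAlls (Fin 1)
    ((φ.relabel (Sum.map Sum.inl id)).imp (Formula.iSup fun i : F =>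
      Term.equal (Term.var (Sum.inr 0)) (Term.var (Sum.inl (Sum.inr i))))))
  have hΦ : ∀ ρ : X → Fin k → M, Φ.Realize (ev ρ) ↔ ∃ x : F → M, ∀ y : Fin 1 → M,
      φ.Realize (Sum.elim (ev ρ) y) → ∃ i, y 0 = x i := by
    intro ρ
    simp only [Φ, Formula.realize_iExs, Formula.realize_iAlls, Formula.realize_imp,
      Formula.realize_iSup, Formula.realize_equal, Formula.realize_relabel, Term.realize_var,
      Sum.elim_inl, Sum.elim_inr]
    refine exists_congr fun x => forall_congr' fun y => ?_
    have : (fun a => Sum.elim (Sum.elim (ev ρ) x) y a) ∘ (Sum.map Sum.inl id) =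
        Sum.elim (ev ρ) y := by
      funext a
      rcases a with a | a <;> simp
    rw [this]
  have h1 : Φ.Realize (ev σ) := by
    rw [hΦ]
    refine ⟨fun x => x.1, fun y hy => ⟨⟨y 0, ?_⟩, rfl⟩⟩
    have : (fun _ : Fin 1 => y 0) = y := by
      funext i
      rw [Subsingleton.elim i 0]
    change φ.Realize (Sum.elim (ev σ) (fun _ => y 0))
    rw [this]
    exact hy
  obtain ⟨x, hx⟩ := (hΦ τ).1 ((indisc hI σ τ hσ hτ hσI hτI Φ).1 h1)
  refine (finite_range x).subset ?_
  intro y hy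
  obtain ⟨i, hi⟩ := hx (fun _ => y) hy
  exact ⟨i, hi.symm⟩

theorem core (hL : L.card ≤ ℵ₀) {k : ℕ} {I : Set (Fin k → M)} (hI : IsIndiscSet (L := L) I)
    (hIc : ¬ I.Countable) (hacl : ∀ b : M, InAcl (L := L) (coords I) b) (h : ℕ → M) :
    ∃ C : Set M, C.Countable ∧ ∀ c : M, ∃ c' ∈ C, ∀ φ : L.Formula (ℕ ⊕ Fin 1),
      φ.Realize (Sum.elim h fun _ => c) → φ.Realize (Sum.elim h fun _ => c') := by
  classical
  choose S hSI hSf hS using fun b => alg_form I b (hacl b)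
  let E : Set (Fin k → M) := ⋃ n, S (h n)
  have hE : E ⊆ I := iUnion_subset fun n => hSI _
  have hEc : E.Countable := countable_iUnion fun n => (hSf _).countable
  have hW : (I \ E).Infinite := by
    intro hf
    exact hIc ((hf.countable.union hEc).mono (by intro x hx; by_cases x ∈ E <;> simp [*]))
  have := hW.to_subtype
  let w : ℕ → Fin k → M := fun n => (Infinite.natEmbedding ↥(I \ E) n).1
  have hw : Function.Injective w := fun a b hab =>
    (Infinite.natEmbedding ↥(I \ E)).injective (Subtype.ext hab)
  have hwW : ∀ n, w n ∈ I \ E := fun n => Subtype.property _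
  have hEalg : ∀ n, AlgOver L (fun x : E => x.1) (h n) := fun n =>
    (hS (h n)).mono (fun x : S (h n) => (⟨x.1, mem_iUnion.2 ⟨n, x.2⟩⟩ : E)) (fun _ => rfl)
  have hsym : Countable L.Symbols := Cardinal.mk_le_aleph0_iff.1 hL
  have := hEc.to_subtype
  let sol : L.Formula (((E ⊕ ℕ) × Fin k) ⊕ Fin 1) → Set M := fun φ =>
    {x : M | φ.Realize (Sum.elim (ev (Sum.elim (fun x : E => x.1) w)) (fun _ => x))}
  refine ⟨⋃ φ : {φ // (sol φ).Finite}, sol φ, countable_iUnion fun φ => φ.2.countable, ?_⟩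
  intro c
  let Z := ↥(S c \ E)
  have : Finite Z := ((hSf c).subset sdiff_subset).to_subtype
  obtain ⟨enc, henc⟩ := exists_injective_nat Z
  let d : Z → Fin k → M := fun z => z.1
  let d' : Z → Fin k → M := fun z => w (enc z)
  have hd : Function.Injective d := Subtype.val_injective
  have hd' : Function.Injective d' := hw.comp henc
  have hdW : ∀ z, d z ∈ I \ E := fun z => ⟨hSI c z.2.1, z.2.2⟩
  have hdW' : ∀ z, d' z ∈ I \ E := fun z => hwW _
  obtain ⟨φ, hφ1, hφ2⟩ : AlgOver L (Sum.elim (fun x : E => x.1) d) c := by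
    refine (hS c).mono (fun x => if hx : x.1 ∈ E then Sum.inl ⟨x.1, hx⟩ else Sum.inr ⟨x.1, x.2, hx⟩)
      (fun x => ?_)
    by_cases hx : x.1 ∈ E <;> simp [hx, d]
  have comb : ∀ d : Z → Fin k → M, Function.Injective d → (∀ z, d z ∈ I \ E) →
      Function.Injective (Sum.elim (fun x : E => x.1) d) ∧
      ∀ x, Sum.elim (fun x : E => x.1) d x ∈ I := by
    intro d h1 h3
    refine ⟨Function.Injective.sumElim Subtype.val_injective h1 ?_, ?_⟩
    · rintro ⟨x, hx⟩ z hh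
      exact (h3 z).2 ((show x = d z from hh) ▸ hx)
    · rintro (⟨x, hx⟩ | z)
      · exact hE hx
      · exact (h3 z).1
  have c1 := comb d hd hdW
  have c2 := comb d' hd' hdW'
  have hfin := fin_transfer hI _ _ c1.1 c2.1 c1.2 c2.2 φ hφ2
  let R := ↥{x : M | φ.Realize (Sum.elim (ev (Sum.elim (fun x : E => x.1) d')) (fun _ => x))}
  have hRf : Finite R := hfin.to_subtype
  have hex : ∃ c' : R, ∀ φ : L.Formula (ℕ ⊕ Fin 1),
      φ.Realize (Sum.elim h fun _ => c) → φ.Realize (Sum.elim h fun _ => c'.1) := by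
    by_contra! hcon
    choose ψ hψ1 hψ2 using hcon
    let Θ : L.Formula (ℕ ⊕ ((E ⊕ Z) × Fin k)) := Formula.iExs (Fin 1)
      (φ.relabel (Sum.map Sum.inr id) ⊓
        Formula.iInf fun c' : R => (ψ c').relabel (Sum.map Sum.inl id))
    have hΘ : ∀ t : (E ⊕ Z) × Fin k → M, Θ.Realize (Sum.elim h t) ↔ ∃ x : Fin 1 → M,
        φ.Realize (Sum.elim t x) ∧ ∀ c' : R, (ψ c').Realize (Sum.elim h x) := by
      intro t
      simp only [Θ, Formula.realize_iExs, Formula.realize_inf, Formula.realize_iInf,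
        Formula.realize_relabel]
      refine exists_congr fun x => ?_
      have e1 : Sum.elim (Sum.elim h t) x ∘ Sum.map Sum.inr id = Sum.elim t x := by
        funext a
        rcases a with a | a <;> simp
      have e2 : Sum.elim (Sum.elim h t) x ∘ Sum.map Sum.inl id = Sum.elim h x := by
        funext a
        rcases a with a | a <;> simp
      rw [e1, e2]
    have h1 := (hΘ (ev (Sum.elim (fun x : E => x.1) d))).2 ⟨fun _ => c, hφ1, hψ1⟩
    have h2 := (key_nat hI hE hW h hEalg Θ d d' hd hd' hdW hdW').1 h1
    obtain ⟨x, hx1, hx2⟩ := (hΘ _).1 h2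
    have hx : x = fun _ : Fin 1 => x 0 := by
      funext i
      rw [Subsingleton.elim i 0]
    generalize x 0 = x0 at hx
    subst hx
    exact hψ2 ⟨x0, hx1⟩ (hx2 ⟨x0, hx1⟩)
  obtain ⟨c', hc'⟩ := hex
  have hsol : sol (φ.relabel (Sum.map (Prod.map (Sum.map id enc) id) id)) =
      {x : M | φ.Realize (Sum.elim (ev (Sum.elim (fun x : E => x.1) d')) (fun _ => x))} := by
    ext x
    simp only [sol, mem_ofPred_eq, Formula.realize_relabel]
    have : Sum.elim (ev (Sum.elim (fun x : E => x.1) w)) (fun _ : Fin 1 => x) ∘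
        (Sum.map (Prod.map (Sum.map id enc) id) id) =
        Sum.elim (ev (Sum.elim (fun x : E => x.1) d')) (fun _ => x) := by
      funext a
      rcases a with ⟨a | a, i⟩ | a <;> simp [ev, d']
    rw [this]
  refine ⟨c'.1, mem_iUnion.2 ⟨⟨_, hsol ▸ hfin⟩, ?_⟩, hc'⟩
  rw [hsol]
  exact c'.2

end Aux

end Paper

open Paper in
/-- every almost indiscernible complete countable theory is ω-stable. -/
theorem stmt_8 {L : FirstOrder.Language.{u, v}} (hL : L.card ≤ ℵ₀)
    (T : L.Theory) (hcomp : T.IsComplete) (hai : AlmostIndiscernible T) :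
    IsOmegaStable T := by
  intro N _ hN A hA
  obtain ⟨M, _, hM, hMc, hsat, k, I, hI, hIc, hacl⟩ := hai
  rcases isEmpty_or_nonempty N with hNe | hNe
  · refine Set.Countable.mono (s₂ := ∅) ?_ countable_empty
    intro p hp
    obtain ⟨a, -⟩ := hp.1 ∅ (by simp)
    exact (hNe.false (a 0)).elim
  have hMne : Nonempty M := by
    rw [← Cardinal.mk_ne_zero_iff, hMc]
    exact (Cardinal.aleph_pos 1).ne'
  have hIc' : ¬ I.Countable := by
    intro hc
    have := Cardinal.mk_le_aleph0_iff.2 hc.to_subtype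
    rw [hIc] at this
    exact absurd Cardinal.aleph0_lt_aleph_one this.not_gt
  obtain ⟨g, hg⟩ := (hA.insert (Classical.arbitrary N)).exists_eq_range (insert_nonempty _ _)
  have hgA : ∀ a : A, ∃ n, g n = a.1 := fun a => by
    have : a.1 ∈ range g := hg ▸ mem_insert_of_mem _ a.2
    exact this
  choose idx hidx using hgA
  obtain ⟨h, hh⟩ := embed (L := L) (M := M) (N := N) hsat (by
    intro φ a b
    have e1 := hcomp.realize_sentence_iff (φ.relabel (Fin.elim0 : Fin 0 → Empty)) N
    have e2 := hcomp.realize_sentence_iff (φ.relabel (Fin.elim0 : Fin 0 → Empty)) M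
    have e3 := e1.trans e2.symm
    simp only [Sentence.Realize, Formula.realize_relabel] at e3
    rwa [Subsingleton.elim (_ ∘ _) a, Subsingleton.elim (_ ∘ _) b] at e3) g
  obtain ⟨C, hC, hCc⟩ := core hL hI hIc' hacl h
  let r : A ⊕ Fin 1 → ℕ ⊕ Fin 1 := Sum.map idx id
  let tp : M → Set (L.Formula (A ⊕ Fin 1)) := fun c =>
    {φ | (φ.relabel r).Realize (Sum.elim h fun _ => c)}
  refine (hC.image tp).mono ?_
  rintro p ⟨hp1, hp2⟩
  obtain ⟨c, hc⟩ := transfer (L := L) hsat h g hh (Set.image (Formula.relabel r) p) (by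
    classical
    intro S hS
    obtain ⟨S', hS', rfl⟩ := Finset.subset_set_image_iff.1 hS
    obtain ⟨a, ha⟩ := hp1 S' hS'
    refine ⟨a, fun φ hφ => ?_⟩
    obtain ⟨φ', h', rfl⟩ := Finset.mem_image.1 hφ
    rw [Formula.realize_relabel]
    have : Sum.elim g a ∘ r = Sum.elim (fun x : A => (x : N)) a := by
      funext x
      rcases x with x | x <;> simp [r, hidx]
    rw [this]
    exact ha _ h')
  have hcc : c = fun _ => c 0 := by
    funext i
    rw [Subsingleton.elim i 0]
  obtain ⟨c', hc'C, hc'⟩ := hCc (c 0)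
  have hsub : ∀ φ ∈ p, φ ∈ tp c' := fun φ hφ => hc' _ (by
    have := hc _ ⟨φ, hφ, rfl⟩
    rwa [hcc] at this)
  refine ⟨c', hc'C, Set.ext fun φ => ⟨fun hφ => ?_, hsub φ⟩⟩
  rcases hp2 φ with h1 | h1
  · exact h1
  · exfalso
    have h2 := hsub _ h1
    have h3 : ¬ (φ.relabel r).Realize (Sum.elim h fun _ => c') := by
      have h2' : (φ.not.relabel r).Realize (Sum.elim h fun _ => c') := h2
      rw [Formula.realize_relabel, Formula.realize_not] at h2'
      rw [Formula.realize_relabel]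
      exact h2'
    exact h3 hφ
end

section
/- Let M be a saturated free algebra on uncountable basis I. Then the type p₀ of a basis element over ∅ is stationary: any two realizations of p₀ in M have the same strong type over ∅ (i.e., lie in the same class of every ∅-definable finite equivalence relation). -/
open FirstOrder Language Cardinal Set

universe u v w

namespace Paper

variable {L : FirstOrder.Language.{u, v}} {M : Type w} [L.Structure M]

/-- A set of pairs is a partial elementary relation. -/
def ElemRel (R : Set (M × M)) : Prop :=
  ∀ (n : ℕ) (p : Fin n → M × M), (∀ i, p i ∈ R) → ∀ φ : L.Formula (Fin n),
    φ.Realize (fun i => (p i).1) ↔ φ.Realize (fun i => (p i).2)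

theorem ElemRel.swap {R : Set (M × M)} (h : ElemRel (L := L) R) :
    ElemRel (L := L) (Prod.swap ⁻¹' R) := by
  intro n p hp φ
  exact (h n (fun i => (p i).swap) hp φ).symm

theorem extend_point (hsat : IsSat (L := L) M ℵ₁) {R : Set (M × M)} (hfin : R.Finite)
    (h : ElemRel (L := L) R) (c : M) : ∃ d, ElemRel (L := L) (insert (c, d) R) := by
  classical
  obtain ⟨n, r, hr⟩ : ∃ (n : ℕ) (r : Fin n → M × M), Set.range r = R := by
    have := hfin.fintype
    refine ⟨Fintype.card R, fun i => ((Fintype.equivFin R).symm i : M × M), ?_⟩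
    ext x
    constructor
    · rintro ⟨i, rfl⟩
      exact Subtype.prop _
    · intro hx
      exact ⟨Fintype.equivFin R ⟨x, hx⟩, by simp⟩
  let A : Set M := Set.range (fun i => (r i).2)
  let g : Fin n → A := fun i => ⟨(r i).2, i, rfl⟩
  have hA : #A < ℵ₁ := by
    have : A.Finite := Set.finite_range _
    have h1 : #A < ℵ₀ := this.lt_aleph0
    exact h1.trans Cardinal.aleph0_lt_aleph_one
  let q : Set (L.Formula (Fin n ⊕ Fin 1)) :=
    {ψ | ψ.Realize (Sum.elim (fun i => (r i).1) (fun _ => c))}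
  have key : ∀ (ψ : L.Formula (Fin n ⊕ Fin 1)) (x : Fin 1 → M),
      (ψ.relabel (Sum.map g id)).Realize (Sum.elim (fun x : A => (x : M)) x) ↔
        ψ.Realize (Sum.elim (fun i => (r i).2) x) := by
    intro ψ x
    rw [Formula.realize_relabel]
    have : (Sum.elim (fun x : A => (x : M)) x) ∘ (Sum.map g id)
        = Sum.elim (fun i => (r i).2) x := by
      funext z
      rcases z with z | z <;> rfl
    rw [this]
  obtain ⟨d, hd⟩ := hsat A hA ((fun ψ => ψ.relabel (Sum.map g id)) '' q) (by
    intro S hS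
    have hS' : ∀ φ : S, ∃ ψ ∈ q, ψ.relabel (Sum.map g id) = (φ : L.Formula (A ⊕ Fin 1)) :=
      fun φ => hS φ.2
    choose ψ hψ hψ2 using hS'
    let θ : L.Formula (Fin n ⊕ Fin 1) := Formula.iInf ψ
    have hθ : (Formula.iExs (Fin 1) θ).Realize (fun i => (r i).1) := by
      rw [Formula.realize_iExs]
      refine ⟨fun _ => c, ?_⟩
      rw [Formula.realize_iInf]
      exact fun φ => hψ φ
    have hθ2 := (h n r (fun i => hr ▸ ⟨i, rfl⟩) _).1 hθ
    rw [Formula.realize_iExs] at hθ2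
    obtain ⟨x, hx⟩ := hθ2
    rw [Formula.realize_iInf] at hx
    refine ⟨x, fun φ hφ => ?_⟩
    have := hx ⟨φ, hφ⟩
    rw [← key, hψ2] at this
    exact this)
  have hd1 : ∀ ψ : L.Formula (Fin n ⊕ Fin 1),
      ψ.Realize (Sum.elim (fun i => (r i).1) (fun _ => c)) →
        ψ.Realize (Sum.elim (fun i => (r i).2) d) := by
    intro ψ hψ
    exact (key ψ d).1 (hd _ ⟨ψ, hψ, rfl⟩)
  have hd2 : ∀ ψ : L.Formula (Fin n ⊕ Fin 1),
      ψ.Realize (Sum.elim (fun i => (r i).1) (fun _ => c)) ↔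
        ψ.Realize (Sum.elim (fun i => (r i).2) d) := by
    intro ψ
    refine ⟨hd1 ψ, fun h2 => ?_⟩
    by_contra h3
    have := hd1 ψ.not (by rw [Formula.realize_not]; exact h3)
    rw [Formula.realize_not] at this
    exact this h2
  refine ⟨d 0, ?_⟩
  intro m p hp φ
  have : ∀ i, ∃ z : Fin n ⊕ Fin 1,
      (p i).1 = Sum.elim (fun i => (r i).1) (fun _ => c) z ∧
      (p i).2 = Sum.elim (fun i => (r i).2) d z := by
    intro i
    rcases hp i with h1 | h1
    · exact ⟨Sum.inr 0, by rw [h1]; exact ⟨rfl, rfl⟩⟩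
    · rw [← hr] at h1
      obtain ⟨j, hj⟩ := h1
      exact ⟨Sum.inl j, by rw [← hj]; exact ⟨rfl, rfl⟩⟩
  choose z hz1 hz2 using this
  have := hd2 (φ.relabel z)
  rw [Formula.realize_relabel, Formula.realize_relabel] at this
  rw [funext hz1, funext hz2]
  exact this

theorem extend_fst (hsat : IsSat (L := L) M ℵ₁) {R : Set (M × M)} (hfin : R.Finite)
    (h : ElemRel (L := L) R) {S : Set M} (hS : S.Finite) :
    ∃ R' : Set (M × M), R ⊆ R' ∧ R'.Finite ∧ ElemRel (L := L) R' ∧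
      ∀ s ∈ S, ∃ d, (s, d) ∈ R' := by
  induction S, hS using Set.Finite.induction_on with
  | empty => exact ⟨R, subset_rfl, hfin, h, by simp⟩
  | @insert c S _ _ ih =>
    obtain ⟨R', h1, h2, h3, h4⟩ := ih
    obtain ⟨d, hd⟩ := extend_point hsat h2 h3 c
    refine ⟨_, h1.trans (Set.subset_insert _ _), h2.insert _, hd, ?_⟩
    rintro s (rfl | hs)
    · exact ⟨d, Or.inl rfl⟩
    · obtain ⟨d', hd'⟩ := h4 s hs
      exact ⟨d', Or.inr hd'⟩

theorem extend_snd (hsat : IsSat (L := L) M ℵ₁) {R : Set (M × M)} (hfin : R.Finite)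
    (h : ElemRel (L := L) R) {S : Set M} (hS : S.Finite) :
    ∃ R' : Set (M × M), R ⊆ R' ∧ R'.Finite ∧ ElemRel (L := L) R' ∧
      ∀ s ∈ S, ∃ d, (d, s) ∈ R' := by
  have hf : ∀ {Q : Set (M × M)}, Q.Finite → (Prod.swap ⁻¹' Q).Finite := fun hQ =>
    hQ.preimage (Prod.swap_injective.injOn)
  obtain ⟨R', h1, h2, h3, h4⟩ := extend_fst hsat (hf hfin) h.swap hS
  refine ⟨Prod.swap ⁻¹' R', fun x hx => h1 (by simpa using hx), hf h2, h3.swap, ?_⟩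
  intro s hs
  obtain ⟨d, hd⟩ := h4 s hs
  exact ⟨d, hd⟩

theorem model_closure {T : L.Theory} (hT : IsEquational T) (hM : M ⊨ T)
    (N : L.Substructure M) : N ⊨ T := by
  refine ⟨fun φ hφ => ?_⟩
  obtain ⟨n, t₁, t₂, rfl⟩ := hT φ hφ
  have h := hM.realize_of_mem _ hφ
  rw [Sentence.Realize, BoundedFormula.realize_alls] at h ⊢
  intro xs
  have h2 := h (fun i => (xs i : M))
  rw [BoundedFormula.realize_bdEqual] at h2 ⊢
  apply Subtype.val_injective
  have e : ∀ t : L.Term (Empty ⊕ Fin n),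
      ((t.realize (Sum.elim (default : Empty → N) xs) : N) : M)
        = t.realize (Sum.elim (default : Empty → M) (fun i => (xs i : M))) := by
    intro t
    have := HomClass.realize_term N.subtype (t := t) (v := Sum.elim (default : Empty → N) xs)
    rw [Substructure.subtype_apply] at this
    rw [← this]
    congr 1
    funext z
    rcases z with z | z
    · exact z.elim
    · rfl
  rw [e, e]
  exact h2

theorem exists_rep {T : L.Theory} (hT : IsEquational T) {I : Set M} (hfree : IsFreeOn T M I)
    (x : M) : ∃ (n : ℕ) (q : Fin n → M) (t : L.Term (Fin n)),
      (∀ i, q i ∈ I) ∧ t.realize q = x := by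
  classical
  let N : L.Substructure M := Substructure.closure L I
  obtain ⟨h, hh, -⟩ := hfree.2 N inferInstance (model_closure hT hfree.1 N)
    (fun i => ⟨i, Substructure.subset_closure i.2⟩)
  obtain ⟨k, -, hk⟩ := hfree.2 M inferInstance hfree.1 (fun i => i)
  have h1 : N.subtype.toHom.comp h = Hom.id L M := by
    rw [hk (N.subtype.toHom.comp h) (fun i => by
      change ((h i : N) : M) = i
      rw [hh i]), hk (Hom.id L M) (fun i => rfl)]
  have hx : x ∈ N := by
    have := congrArg (fun f : M →[L] M => f x) h1
    change ((h x : N) : M) = x at this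
    rw [← this]
    exact (h x).2
  obtain ⟨t, ht⟩ := Substructure.mem_closure_iff_exists_term.1 hx
  let F := t.varFinset
  let eF := Fintype.equivFin F
  refine ⟨Fintype.card F, fun i => ((eF.symm i : I) : M), t.restrictVar eF, fun i => Subtype.prop _, ?_⟩
  rw [← ht]
  exact Term.realize_restrictVar _ (by intro a; simp)

theorem step {T : L.Theory} (hT : IsEquational T) {I : Set M} (hfree : IsFreeOn T M I)
    (hsat : IsSat (L := L) M ℵ₁) {R : Set (M × M)} (hfin : R.Finite)
    (h : ElemRel (L := L) R) :
    ∃ R' : Set (M × M), R ⊆ R' ∧ R'.Finite ∧ ElemRel (L := L) R' ∧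
      (∀ p ∈ R, ∃ (n : ℕ) (q : Fin n → M × M) (t : L.Term (Fin n)),
        (∀ i, (q i).1 ∈ I ∧ q i ∈ R') ∧ t.realize (fun i => (q i).1) = p.1) ∧
      (∀ p ∈ R, ∃ (n : ℕ) (q : Fin n → M × M) (t : L.Term (Fin n)),
        (∀ i, (q i).2 ∈ I ∧ q i ∈ R') ∧ t.realize (fun i => (q i).2) = p.2) := by
  choose n q t hq ht using fun x => exists_rep hT hfree x
  obtain ⟨R₁, a1, a2, a3, a4⟩ := extend_fst hsat hfin h
    (S := ⋃ p ∈ R, Set.range (q p.1)) (hfin.biUnion fun p _ => Set.finite_range _)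
  obtain ⟨R₂, b1, b2, b3, b4⟩ := extend_snd hsat a2 a3
    (S := ⋃ p ∈ R, Set.range (q p.2)) (hfin.biUnion fun p _ => Set.finite_range _)
  refine ⟨R₂, a1.trans b1, b2, b3, ?_, ?_⟩
  · intro p hp
    have : ∀ i, ∃ d, (q p.1 i, d) ∈ R₁ := fun i =>
      a4 _ (Set.mem_biUnion hp ⟨i, rfl⟩)
    choose d hd using this
    exact ⟨n p.1, fun i => (q p.1 i, d i), t p.1, fun i => ⟨hq _ i, b1 (hd i)⟩, ht _⟩
  · intro p hp
    have : ∀ i, ∃ d, (d, q p.2 i) ∈ R₂ := fun i =>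
      b4 _ (Set.mem_biUnion hp ⟨i, rfl⟩)
    choose d hd using this
    exact ⟨n p.2, fun i => (d i, q p.2 i), t p.2, fun i => ⟨hq _ i, hd i⟩, ht _⟩

/-- Closed countable elementary relations. -/
theorem exists_closed {T : L.Theory} (hT : IsEquational T) {I : Set M} (hfree : IsFreeOn T M I)
    (hsat : IsSat (L := L) M ℵ₁) {R₀ : Set (M × M)} (hfin : R₀.Finite)
    (h : ElemRel (L := L) R₀) :
    ∃ R : Set (M × M), R₀ ⊆ R ∧ R.Countable ∧ ElemRel (L := L) R ∧
      (∀ p ∈ R, ∃ (n : ℕ) (q : Fin n → M × M) (t : L.Term (Fin n)),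
        (∀ i, (q i).1 ∈ I ∧ q i ∈ R) ∧ t.realize (fun i => (q i).1) = p.1) ∧
      (∀ p ∈ R, ∃ (n : ℕ) (q : Fin n → M × M) (t : L.Term (Fin n)),
        (∀ i, (q i).2 ∈ I ∧ q i ∈ R) ∧ t.realize (fun i => (q i).2) = p.2) := by
  let P := {R : Set (M × M) // R.Finite ∧ ElemRel (L := L) R}
  choose f f1 f2 f3 f4 f5 using fun R : P => step hT hfree hsat R.2.1 R.2.2
  let s : ℕ → P := fun k => Nat.rec ⟨R₀, hfin, h⟩ (fun _ R => ⟨f R, f2 R, f3 R⟩) k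
  have hs : ∀ k, (s (k + 1)).1 = f (s k) := fun k => rfl
  have hmono : Monotone (fun k => (s k).1) := monotone_nat_of_le_succ fun k => f1 (s k)
  refine ⟨⋃ k, (s k).1, Set.subset_iUnion (fun k => (s k).1) 0,
    Set.countable_iUnion fun k => (s k).2.1.countable, ?_, ?_, ?_⟩
  · intro n p hp φ
    have : ∀ i, ∃ k, p i ∈ (s k).1 := fun i => Set.mem_iUnion.1 (hp i)
    choose k hk using this
    exact (s (Finset.univ.sup k)).2.2 n p
      (fun i => hmono (Finset.le_sup (Finset.mem_univ i)) (hk i)) φ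
  · intro p hp
    obtain ⟨k, hk⟩ := Set.mem_iUnion.1 hp
    obtain ⟨n, q, t, h1, h2⟩ := f4 (s k) p hk
    exact ⟨n, q, t, fun i => ⟨(h1 i).1, Set.mem_iUnion.2 ⟨k + 1, (h1 i).2⟩⟩, h2⟩
  · intro p hp
    obtain ⟨k, hk⟩ := Set.mem_iUnion.1 hp
    obtain ⟨n, q, t, h1, h2⟩ := f5 (s k) p hk
    exact ⟨n, q, t, fun i => ⟨(h1 i).1, Set.mem_iUnion.2 ⟨k + 1, (h1 i).2⟩⟩, h2⟩

theorem ElemRel.term {R : Set (M × M)} (h : ElemRel (L := L) R) {n : ℕ} {q : Fin n → M × M}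
    (hq : ∀ i, q i ∈ R) (t : L.Term (Fin n)) {p : M × M} (hp : p ∈ R)
    (ht : t.realize (fun i => (q i).1) = p.1) : t.realize (fun i => (q i).2) = p.2 := by
  let r : Fin (n + 1) → M × M := Fin.snoc q p
  have hr : ∀ i, r i ∈ R := by
    intro i
    refine Fin.lastCases ?_ (fun j => ?_) i
    · simpa [r] using hp
    · simpa [r] using hq j
  have := h (n + 1) r hr
    (Term.equal (t.relabel Fin.castSucc) (Term.var (Fin.last n)))
  rw [Formula.realize_equal, Formula.realize_equal, Term.realize_relabel,
    Term.realize_relabel, Term.realize_var, Term.realize_var] at this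
  have e1 : (fun i => (r i).1) ∘ Fin.castSucc = fun i => (q i).1 := by
    funext i
    simp [r]
  have e2 : (fun i => (r i).2) ∘ Fin.castSucc = fun i => (q i).2 := by
    funext i
    simp [r]
  rw [e1, e2] at this
  simp only [r, Fin.snoc_last] at this
  exact this.1 ht

theorem hom_agree {R : Set (M × M)} (h : ElemRel (L := L) R) {I : Set M}
    (hc : ∀ p ∈ R, ∃ (n : ℕ) (q : Fin n → M × M) (t : L.Term (Fin n)),
        (∀ i, (q i).1 ∈ I ∧ q i ∈ R) ∧ t.realize (fun i => (q i).1) = p.1)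
    (f : M →[L] M) (hf : ∀ p ∈ R, p.1 ∈ I → f p.1 = p.2) : ∀ p ∈ R, f p.1 = p.2 := by
  intro p hp
  obtain ⟨n, q, t, h1, h2⟩ := hc p hp
  have h3 := h.term (fun i => (h1 i).2) t hp h2
  rw [← h2, ← h3, ← HomClass.realize_term]
  congr 1
  funext i
  exact hf _ (h1 i).2 (h1 i).1

theorem ElemRel.inj {R : Set (M × M)} (h : ElemRel (L := L) R) {x y z : M}
    (h1 : (x, y) ∈ R) (h2 : (x, z) ∈ R) : y = z := by
  have := h.term (n := 1) (q := fun _ => (x, y)) (fun _ => h1) (Term.var 0) h2 rfl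
  simpa using this

theorem hom_id {T : L.Theory} {I : Set M} (hfree : IsFreeOn T M I) (f : M →[L] M)
    (hf : ∀ i ∈ I, f i = i) : ∀ x, f x = x := by
  obtain ⟨k, -, hk⟩ := hfree.2 M inferInstance hfree.1 (fun i => i)
  have : f = Hom.id L M := by
    rw [hk f (fun i => hf i i.2), hk (Hom.id L M) (fun i => rfl)]
  intro x
  rw [this]
  rfl

theorem exists_equiv {T : L.Theory} {I : Set M} (hfree : IsFreeOn T M I) (f g : M →[L] M)
    (hf : ∀ i ∈ I, g (f i) = i) (hg : ∀ i ∈ I, f (g i) = i) :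
    ∃ F : M ≃[L] M, ∀ x, F x = f x := by
  have h1 : ∀ x, g (f x) = x := hom_id hfree (g.comp f) hf
  have h2 : ∀ x, f (g x) = x := hom_id hfree (f.comp g) hg
  refine ⟨{ toFun := f, invFun := g, left_inv := h1, right_inv := h2,
            map_fun' := fun φ x => f.map_fun φ x
            map_rel' := fun r x => ⟨fun h => ?_, fun h => f.map_rel r x h⟩ }, fun x => rfl⟩
  have h3 := g.map_rel r _ h
  have h4 : (g ∘ f ∘ x) = x := funext fun i => h1 (x i)
  have h5 : g ∘ ((f : M → M) ∘ x) = x := h4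
  rw [← h5]
  exact h3

theorem equiv_E (F : M ≃[L] M) (E : L.Formula (Fin 2)) {x y : M} (h : E.Realize ![x, y]) :
    E.Realize ![F x, F y] := by
  have := (StrongHomClass.realize_formula F E (v := ![x, y])).2 h
  have e : (F ∘ ![x, y]) = ![F x, F y] := by
    funext i
    fin_cases i <;> rfl
  rwa [e] at this

theorem basis_E {T : L.Theory} {I : Set M} (hfree : IsFreeOn T M I) (hinf : I.Infinite)
    (E : L.Formula (Fin 2))
    (hrefl : ∀ x : M, E.Realize ![x, x])
    (hsymm : ∀ x y : M, E.Realize ![x, y] → E.Realize ![y, x])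
    (htrans : ∀ x y z : M, E.Realize ![x, y] → E.Realize ![y, z] → E.Realize ![x, z])
    (hfin : ∃ S : Finset M, ∀ x : M, ∃ s ∈ S, E.Realize ![x, s]) {i j : M}
    (hi : i ∈ I) (hj : j ∈ I) : E.Realize ![i, j] := by
  classical
  by_cases hij : i = j
  · rw [hij]
    exact hrefl j
  obtain ⟨S, hS⟩ := hfin
  choose c hc hcE using hS
  obtain ⟨k, hk, l, hl, hkl, hcc⟩ := hinf.exists_ne_map_eq_of_mapsTo
    (f := c) (t := (S : Set M)) (fun x _ => hc x) S.finite_toSet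
  have hE : E.Realize ![k, l] := htrans _ _ _ (hcE k) (by rw [hcc]; exact hsymm _ _ (hcE l))
  obtain ⟨π, h1, h2⟩ : ∃ π : Equiv.Perm I, π ⟨k, hk⟩ = ⟨i, hi⟩ ∧ π ⟨l, hl⟩ = ⟨j, hj⟩ := by
    let π₁ : Equiv.Perm I := Equiv.swap ⟨k, hk⟩ ⟨i, hi⟩
    refine ⟨π₁.trans (Equiv.swap (π₁ ⟨l, hl⟩) ⟨j, hj⟩), ?_, ?_⟩
    · have a1 : π₁ ⟨k, hk⟩ = ⟨i, hi⟩ := Equiv.swap_apply_left _ _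
      rw [Equiv.trans_apply, Equiv.swap_apply_of_ne_of_ne]
      · exact a1
      · intro h
        exact hkl (congrArg Subtype.val (π₁.injective h))
      · rw [a1]
        intro h
        exact hij (congrArg Subtype.val h)
    · rw [Equiv.trans_apply, Equiv.swap_apply_left]
  obtain ⟨f, hf, -⟩ := hfree.2 M inferInstance hfree.1 (fun x => (π x : M))
  obtain ⟨g, hg, -⟩ := hfree.2 M inferInstance hfree.1 (fun x => (π.symm x : M))
  obtain ⟨F, hF⟩ := exists_equiv hfree f g
    (fun x hx => by rw [hf ⟨x, hx⟩, hg]; simp) (fun x hx => by rw [hg ⟨x, hx⟩, hf]; simp)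
  have := equiv_E F E hE
  rwa [hF, hF, hf ⟨k, hk⟩, hf ⟨l, hl⟩, h1, h2] at this

theorem main_aux {T : L.Theory} (hT : IsEquational T) {I : Set M} (hcard : #I = ℵ₁)
    (hfree : IsFreeOn T M I) (hsat : IsSat (L := L) M ℵ₁)
    (e : M) (he : e ∈ I) (a : M)
    (ha : SameType₀ (L := L) (fun _ : Fin 1 => a) (fun _ => e)) :
    ∃ (F : M ≃[L] M) (i : M), i ∈ I ∧ F e = a ∧ F i ∈ I := by
  classical
  have h0 : ElemRel (L := L) {(e, a)} := by
    intro n p hp φ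
    have := ha (φ.relabel fun _ => 0)
    rw [Formula.realize_relabel, Formula.realize_relabel] at this
    have hp' : p = fun _ => (e, a) := funext hp
    rw [hp']
    exact this.symm
  obtain ⟨R, r0, rc, rel, hc1, hc2⟩ := exists_closed hT hfree hsat (Set.finite_singleton _) h0
  let A : Set I := {i | ∃ d, ((i : M), d) ∈ R}
  let B : Set I := {i | ∃ d, (d, (i : M)) ∈ R}
  have hA : A.Countable := by
    have : (Prod.fst '' R).Countable := rc.image _
    refine (this.preimage_of_injOn (f := (Subtype.val : I → M))
      Subtype.val_injective.injOn).mono ?_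
    rintro i ⟨d, hd⟩
    exact ⟨_, hd, rfl⟩
  have hB : B.Countable := by
    have : (Prod.snd '' R).Countable := rc.image _
    refine (this.preimage_of_injOn (f := (Subtype.val : I → M))
      Subtype.val_injective.injOn).mono ?_
    rintro i ⟨d, hd⟩
    exact ⟨_, hd, rfl⟩
  have hinf : ℵ₀ ≤ #I := by rw [hcard]; exact Cardinal.aleph0_lt_aleph_one.le
  have : Infinite I := Cardinal.infinite_iff.2 hinf
  have hcompl : ∀ C : Set I, C.Countable → #(Cᶜ : Set I) = #I := by
    intro C hC
    apply Cardinal.mk_compl_of_infinite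
    rw [hcard]
    exact hC.le_aleph0.trans_lt Cardinal.aleph0_lt_aleph_one
  obtain ⟨γ⟩ : Nonempty ((Aᶜ : Set I) ≃ (Bᶜ : Set I)) :=
    Cardinal.eq.1 ((hcompl A hA).trans (hcompl B hB).symm)
  let τ : I → M := fun i => if h : i ∈ A then h.choose else ((γ ⟨i, h⟩ : I) : M)
  let σ : I → M := fun i => if h : i ∈ B then h.choose else ((γ.symm ⟨i, h⟩ : I) : M)
  obtain ⟨f, hf, -⟩ := hfree.2 M inferInstance hfree.1 τ
  obtain ⟨g, hg, -⟩ := hfree.2 M inferInstance hfree.1 σ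
  have hfR : ∀ p ∈ R, f p.1 = p.2 := by
    refine hom_agree rel hc1 f ?_
    rintro ⟨x, y⟩ hp hx
    have hxA : (⟨x, hx⟩ : I) ∈ A := ⟨y, hp⟩
    rw [hf ⟨x, hx⟩]
    simp only [τ, dif_pos hxA]
    exact rel.inj hxA.choose_spec hp
  have hgR : ∀ p ∈ R, g p.2 = p.1 := by
    have := hom_agree (R := Prod.swap ⁻¹' R) rel.swap (I := I) (by
      intro p hp
      obtain ⟨n, q, t, h1, h2⟩ := hc2 p.swap hp
      exact ⟨n, fun i => (q i).swap, t, fun i => ⟨(h1 i).1, by simpa using (h1 i).2⟩, h2⟩) g (by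
      rintro ⟨x, y⟩ hp hx
      have hxB : (⟨x, hx⟩ : I) ∈ B := ⟨y, hp⟩
      rw [hg ⟨x, hx⟩]
      simp only [σ, dif_pos hxB]
      exact rel.swap.inj (x := x) hxB.choose_spec hp)
    intro p hp
    exact this p.swap (by simpa using hp)
  have hfc : ∀ i : (Aᶜ : Set I), f (i : I) = (γ i : I) := by
    intro i
    rw [hf i]
    have : (i : I) ∉ A := i.2
    simp only [τ, dif_neg this]
  have hgc : ∀ i : (Bᶜ : Set I), g (i : I) = (γ.symm i : I) := by
    intro i
    rw [hg i]
    have : (i : I) ∉ B := i.2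
    simp only [σ, dif_neg this]
  obtain ⟨F, hF⟩ := exists_equiv hfree f g
    (by
      intro x hx
      by_cases h : (⟨x, hx⟩ : I) ∈ A
      · obtain ⟨d, hd⟩ := h
        rw [hfR _ hd, hgR _ hd]
      · rw [hfc ⟨⟨x, hx⟩, h⟩, hgc, Equiv.symm_apply_apply])
    (by
      intro x hx
      by_cases h : (⟨x, hx⟩ : I) ∈ B
      · obtain ⟨d, hd⟩ := h
        rw [hgR _ hd, hfR _ hd]
      · rw [hgc ⟨⟨x, hx⟩, h⟩, hfc, Equiv.apply_symm_apply])
  have hne : Nonempty (Aᶜ : Set I) := by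
    rw [← Cardinal.mk_ne_zero_iff, hcompl A hA, hcard]
    exact (Cardinal.aleph_pos 1).ne'
  obtain ⟨i⟩ := hne
  refine ⟨F, (i : I), (i : I).2, ?_, ?_⟩
  · rw [hF]
    exact hfR (e, a) (r0 rfl)
  · rw [hF, hfc]
    exact Subtype.prop _

end Paper

open Paper in
/-- in a saturated free algebra, the type `p₀` of a basis element over `∅` is
stationary: any two realizations lie in the same class of every `∅`-definable finite
equivalence relation. -/
theorem stmt_9 {L : FirstOrder.Language.{u, v}} (hfun : ∀ n, IsEmpty (L.Relations n))
    (T : L.Theory) (hT : IsEquational T)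
    (M : Type w) [L.Structure M] (I : Set M) (hcard : #I = ℵ₁)
    (hfree : IsFreeOn T M I) (hsat : IsSat (L := L) M ℵ₁)
    (e : M) (he : e ∈ I) (a b : M)
    (ha : SameType₀ (L := L) (fun _ : Fin 1 => a) (fun _ => e))
    (hb : SameType₀ (L := L) (fun _ : Fin 1 => b) (fun _ => e))
    (E : L.Formula (Fin 2))
    (hrefl : ∀ x : M, E.Realize ![x, x])
    (hsymm : ∀ x y : M, E.Realize ![x, y] → E.Realize ![y, x])
    (htrans : ∀ x y z : M, E.Realize ![x, y] → E.Realize ![y, z] → E.Realize ![x, z])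
    (hfin : ∃ S : Finset M, ∀ x : M, ∃ s ∈ S, E.Realize ![x, s]) :
    E.Realize ![a, b] := by
  have hinf : I.Infinite := by
    rw [← Set.infinite_coe_iff, Cardinal.infinite_iff, hcard]
    exact Cardinal.aleph0_lt_aleph_one.le
  have hI : ∀ i ∈ I, ∀ j ∈ I, E.Realize ![i, j] := fun i hi j hj =>
    basis_E hfree hinf E hrefl hsymm htrans hfin hi hj
  have hmain : ∀ c : M, SameType₀ (L := L) (fun _ : Fin 1 => c) (fun _ => e) →
      E.Realize ![c, e] := by
    intro c hc
    obtain ⟨F, i, hi, h1, h2⟩ := main_aux hT hcard hfree hsat e he c hc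
    have h3 := equiv_E F E (hI e he i hi)
    rw [h1] at h3
    exact htrans _ _ _ h3 (hI _ h2 e he)
  exact htrans _ _ _ (hmain a ha) (hsymm _ _ (hmain b hb))
end
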